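/- arXiv:2309.14790 — 6 statements merged into one kernel-verified Lean document; each statement's English description precedes it below -/
import Mathlib

section
/- Fix t ∈ ℤ. If δ(P^{s,t}) → 0 as s → −∞, then there exists an n×n row-stochastic matrix Q^t all of whose rows are equal (a rank-one stochastic matrix) such that P^{s,t}(x,y) → Q^t(x,y) as s → −∞, for all x,y ∈ [n]. -/
open Filter

/-- A row-stochastic `n × n` real matrix. -/
def IsStochastic (n : ℕ) (P : Matrix (Fin n) (Fin n) ℝ) : Prop :=
  (∀ x y, 0 ≤ P x y) ∧ ∀ x, ∑ y, P x y = 1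

/-- Dobrushin ergodic coefficient. -/
noncomputable def dob (n : ℕ) (P : Matrix (Fin n) (Fin n) ℝ) : ℝ :=
  ⨆ x : Fin n, ⨆ y : Fin n, (1 / 2) * ∑ z, |P x z - P y z|

/-- The product `P^{s,t} = P_{s+1} P_{s+2} ⋯ P_t` (the identity when `s ≥ t`). -/
noncomputable def mprod (n : ℕ) (P : ℤ → Matrix (Fin n) (Fin n) ℝ) (s t : ℤ) :
    Matrix (Fin n) (Fin n) ℝ :=
  ((List.range (t - s).toNat).map (fun i => P (s + 1 + i))).prod

theorem isStochastic_iff_mem_rowStochastic {n : ℕ} {P : Matrix (Fin n) (Fin n) ℝ} :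
    IsStochastic n P ↔ P ∈ Matrix.rowStochastic ℝ (Fin n) :=
  Matrix.mem_rowStochastic_iff_sum.symm

theorem IsStochastic.mprod {n : ℕ} {P : ℤ → Matrix (Fin n) (Fin n) ℝ}
    (hP : ∀ s, IsStochastic n (P s)) (s t : ℤ) : IsStochastic n (mprod n P s t) := by
  rw [isStochastic_iff_mem_rowStochastic]
  refine Submonoid.list_prod_mem _ fun A hA => ?_
  obtain ⟨i, -, rfl⟩ := List.mem_map.1 hA
  exact isStochastic_iff_mem_rowStochastic.1 (hP _)

theorem mprod_eq_prod_map_range {n : ℕ} (P : ℤ → Matrix (Fin n) (Fin n) ℝ) (s t : ℤ) :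
    mprod n P s t = ((List.range (t - s).toNat).map fun i : ℕ => P (s + 1 + (i : ℤ))).prod := by
  simp [mprod, Function.comp_def, ← List.map_eq_flatMap]

theorem mprod_mul_mprod {n : ℕ} (P : ℤ → Matrix (Fin n) (Fin n) ℝ) {r s t : ℤ}
    (hrs : r ≤ s) (hst : s ≤ t) : mprod n P r s * mprod n P s t = mprod n P r t := by
  have hlen : (t - r).toNat = (s - r).toNat + (t - s).toNat := by lia
  simp only [mprod_eq_prod_map_range]
  rw [hlen, List.range_add, List.map_append, List.prod_append, List.map_map]
  congr 3
  funext i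
  simp only [Function.comp_apply]
  congr 1
  lia

theorem abs_sub_le_two_mul_dob {n : ℕ} (P : Matrix (Fin n) (Fin n) ℝ) (x y z : Fin n) :
    |P x z - P y z| ≤ 2 * dob n P := by
  have hterm : |P x z - P y z| ≤ ∑ w, |P x w - P y w| :=
    Finset.single_le_sum (f := fun w => |P x w - P y w|) (fun _ _ => abs_nonneg _)
      (Finset.mem_univ z)
  have hy : (1 / 2) * ∑ w, |P x w - P y w| ≤ ⨆ y, (1 / 2) * ∑ w, |P x w - P y w| :=
    le_ciSup (f := fun y => (1 / 2) * ∑ w, |P x w - P y w|) (Set.finite_range _).bddAbove y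
  have hx : (⨆ y, (1 / 2) * ∑ w, |P x w - P y w|) ≤ dob n P :=
    le_ciSup (f := fun x => ⨆ y, (1 / 2) * ∑ w, |P x w - P y w|) (Set.finite_range _).bddAbove x
  linarith

/-- Averaging the rows of `B` with stochastic weights keeps each entry within `2 * dob n B` of
every entry of `B` in the same column. -/
theorem IsStochastic.abs_mul_apply_sub_le {n : ℕ} {A : Matrix (Fin n) (Fin n) ℝ}
    (hA : IsStochastic n A) (B : Matrix (Fin n) (Fin n) ℝ) (x y z : Fin n) :
    |(A * B) x z - B y z| ≤ 2 * dob n B := by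
  have hsub : (A * B) x z - B y z = ∑ w, A x w * (B w z - B y z) := by
    simp only [mul_sub, Finset.sum_sub_distrib, ← Finset.sum_mul, hA.2 x, one_mul,
      Matrix.mul_apply]
  calc |(A * B) x z - B y z| ≤ ∑ w, |A x w * (B w z - B y z)| :=
        hsub ▸ Finset.abs_sum_le_sum_abs _ _
    _ ≤ ∑ w, A x w * (2 * dob n B) := by
        refine Finset.sum_le_sum fun w _ => ?_
        rw [abs_mul, abs_of_nonneg (hA.1 x w)]
        exact mul_le_mul_of_nonneg_left (abs_sub_le_two_mul_dob B w y z) (hA.1 x w)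
    _ = 2 * dob n B := by rw [← Finset.sum_mul, hA.2 x, one_mul]

theorem exists_tendsto_mprod_apply {n : ℕ} {P : ℤ → Matrix (Fin n) (Fin n) ℝ}
    (hP : ∀ s, IsStochastic n (P s)) {t : ℤ}
    (hδ : Tendsto (fun s : ℤ => dob n (mprod n P s t)) atBot (nhds 0)) (x y : Fin n) :
    ∃ q, Tendsto (fun s : ℤ => mprod n P s t x y) atBot (nhds q) := by
  refine cauchy_map_iff_exists_tendsto.1 (Metric.cauchy_iff.2 ⟨inferInstance, fun ε hε => ?_⟩)
  obtain ⟨s, hsδ, hst⟩ :=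
    ((hδ.eventually_lt_const (show (0 : ℝ) < ε / 4 by positivity)).and
      (eventually_le_atBot t)).exists
  have hclose : ∀ r ≤ s, |mprod n P r t x y - mprod n P s t x y| < ε / 2 := fun r hr => by
    rw [← mprod_mul_mprod P hr hst]
    linarith [(IsStochastic.mprod hP r s).abs_mul_apply_sub_le (mprod n P s t) x x y]
  refine ⟨_, image_mem_map (Iic_mem_atBot s), ?_⟩
  rintro _ ⟨r, hr, rfl⟩ _ ⟨r', hr', rfl⟩
  have h := dist_triangle_right (mprod n P r t x y) (mprod n P r' t x y) (mprod n P s t x y)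
  simp only [Real.dist_eq] at h ⊢
  linarith [hclose r hr, hclose r' hr']

/-- If `δ(P^{s,t}) → 0` as `s → −∞`, then there is a rank-one row-stochastic matrix `Q^t`
(all rows equal) with `P^{s,t}(x,y) → Q^t(x,y)` as `s → −∞` for all `x, y`. -/
theorem exists_rank_one_limit (n : ℕ) (hn : 1 ≤ n)
    (P : ℤ → Matrix (Fin n) (Fin n) ℝ) (hP : ∀ s, IsStochastic n (P s)) (t : ℤ)
    (hδ : Tendsto (fun s : ℤ => dob n (mprod n P s t)) atBot (nhds 0)) :
    ∃ Q : Matrix (Fin n) (Fin n) ℝ, IsStochastic n Q ∧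
      (∀ x x' y, Q x y = Q x' y) ∧
      ∀ x y, Tendsto (fun s : ℤ => mprod n P s t x y) atBot (nhds (Q x y)) := by
  choose Q hQ using exists_tendsto_mprod_apply hP hδ
  refine ⟨Q, ⟨fun x y => ?_, fun x => ?_⟩, fun x x' y => ?_, hQ⟩
  · exact ge_of_tendsto' (hQ x y) fun s => (IsStochastic.mprod hP s t).1 x y
  · refine tendsto_nhds_unique (tendsto_finsetSum _ fun y _ => hQ x y) ?_
    simp only [(IsStochastic.mprod hP _ t).2 x, tendsto_const_nhds]
  · have hzero : Tendsto (fun s => mprod n P s t x y - mprod n P s t x' y) atBot (nhds 0) :=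
      squeeze_zero_norm (fun s => abs_sub_le_two_mul_dob _ x x' y) (by simpa using hδ.const_mul 2)
    exact sub_eq_zero.1 (tendsto_nhds_unique ((hQ x y).sub (hQ x' y)) hzero)
end

section
/- One-step martingale property of the evolving set: for every subset S ⊆ [n], the Lebesgue integral over u ∈ [0,1] of π'(S'(u)) := Σ_{y∈S'(u)} π'(y) equals π(S) := Σ_{x∈S} π(x). In other words, ∫_0^1 π'(S'(u)) du = π(S). -/
open MeasureTheory

/-- The stationary flow `Q(S,y) = ∑_{x∈S} π(x) P(x,y)`. -/
noncomputable def flowQ (n : ℕ) (P : Matrix (Fin n) (Fin n) ℝ) (π : Fin n → ℝ)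
    (S : Finset (Fin n)) (y : Fin n) : ℝ :=
  ∑ x ∈ S, π x * P x y

/-- `π'(S'(u))`: the `π' = πP` mass of the one-step evolving set
`S'(u) = {y : Q(S,y) ≥ u·π'(y)}`. -/
noncomputable def evolvedMass (n : ℕ) (P : Matrix (Fin n) (Fin n) ℝ) (π : Fin n → ℝ)
    (S : Finset (Fin n)) (u : ℝ) : ℝ :=
  ∑ y, Set.indicator {y : Fin n | u * (∑ x, π x * P x y) ≤ flowQ n P π S y}
    (fun y => ∑ x, π x * P x y) y

/-- A step function of height `a` that is cut off at `u = q / a` is interval integrable. -/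
theorem intervalIntegrable_ite_mul_le (a q s t : ℝ) :
    IntervalIntegrable (fun u : ℝ => if u * a ≤ q then a else 0) volume s t := by
  have h : MeasurableSet {u : ℝ | u * a ≤ q} :=
    measurableSet_le (by fun_prop) measurable_const
  exact (intervalIntegrable_const (c := a)).mono_fun
    (Measurable.ite h measurable_const measurable_const).aestronglyMeasurable
    (Filter.Eventually.of_forall fun u => by dsimp only; split_ifs <;> simp)

/-- A step function of height `a` that is cut off at `u = q / a` has mass `q` on `[0, 1]`. -/
theorem integral_ite_mul_le {a q : ℝ} (hq : 0 ≤ q) (hqa : q ≤ a) :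
    ∫ u in (0:ℝ)..1, (if u * a ≤ q then a else 0) = q := by
  rcases (hq.trans hqa).eq_or_lt with rfl | ha
  · simp [le_antisymm hqa hq]
  · have h : (fun u : ℝ => if u * a ≤ q then a else 0)
        = Set.indicator {u | u ≤ q / a} fun _ => a := by
      ext u
      simp [Set.indicator_apply, le_div_iff₀ ha]
    rw [h, intervalIntegral.integral_indicator ⟨by positivity, (div_le_one ha).2 hqa⟩]
    simp [ha.ne']

/-- One-step martingale property of the evolving set:
`∫_0^1 π'(S'(u)) du = π(S)`. -/
theorem evolving_set_martingale (n : ℕ) (hn : 1 ≤ n)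
    (P : Matrix (Fin n) (Fin n) ℝ)
    (hP : (∀ x y, 0 ≤ P x y) ∧ ∀ x, ∑ y, P x y = 1)
    (π : Fin n → ℝ) (hπ0 : ∀ x, 0 ≤ π x) (hπ1 : ∑ x, π x = 1)
    (S : Finset (Fin n)) :
    ∫ u in (0:ℝ)..1, evolvedMass n P π S u = ∑ x ∈ S, π x := by
  have hnn (x y : Fin n) : 0 ≤ π x * P x y := mul_nonneg (hπ0 x) (hP.1 x y)
  simp only [evolvedMass, Set.indicator_apply, Set.mem_ofPred_eq]
  rw [intervalIntegral.integral_finsetSum fun y _ => intervalIntegrable_ite_mul_le _ _ _ _]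
  calc _ = ∑ y, flowQ n P π S y := Finset.sum_congr rfl fun y _ =>
        integral_ite_mul_le (Finset.sum_nonneg fun x _ => hnn x y)
          (Finset.sum_le_univ_sum_of_nonneg fun x => hnn x y)
    _ = ∑ x ∈ S, π x := by
        simp only [flowQ]
        rw [Finset.sum_comm]
        simp [← Finset.mul_sum, hP.2]
end

section
/- Let S ⊆ [n] with π(S) > 0. Define φ(S) := (1/(2π(S)))·Σ_{y∈[n]} min(Q(S,y), Q(S^c,y)) and ψ(S) := 1 − ∫_0^1 √(π'(S'(u))/π(S)) du (Lebesgue integral over u ∈ [0,1]). Then 1 − ψ(S) ≤ (√(1+2φ(S)) + √(1−2φ(S)))/2 ≤ 1 − φ(S)²/2. -/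
open MeasureTheory

/-- `φ(S) = (1/(2π(S))) ∑_y min(Q(S,y), Q(Sᶜ,y))`. -/
noncomputable def phi (n : ℕ) (P : Matrix (Fin n) (Fin n) ℝ) (π : Fin n → ℝ)
    (S : Finset (Fin n)) : ℝ :=
  (1 / (2 * ∑ x ∈ S, π x)) * ∑ y, min (flowQ n P π S y) (flowQ n P π Sᶜ y)

/-- `ψ(S) = 1 − ∫_0^1 √(π'(S'(u))/π(S)) du`. -/
noncomputable def psi (n : ℕ) (P : Matrix (Fin n) (Fin n) ℝ) (π : Fin n → ℝ)
    (S : Finset (Fin n)) : ℝ :=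
  1 - ∫ u in (0:ℝ)..1, Real.sqrt (evolvedMass n P π S u / ∑ x ∈ S, π x)

lemma antitone_threshold {p : ℝ} (q : ℝ) (hp : 0 ≤ p) :
    Antitone fun u : ℝ => if u * p ≤ q then p else 0 := by
  intro u v huv
  have h : u * p ≤ v * p := mul_le_mul_of_nonneg_right huv hp
  dsimp only
  split_ifs <;> linarith

lemma integral_threshold {p q c : ℝ} (hp : 0 ≤ p) (hq : 0 ≤ q) (hc : 0 ≤ c) :
    ∫ u in (0:ℝ)..c, (if u * p ≤ q then p else 0) = min (c * p) q := by
  rcases hp.eq_or_lt with rfl | hp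
  · simp [hq]
  have below : ∀ d : ℝ, 0 ≤ d → d * p ≤ q →
      ∫ u in (0:ℝ)..d, (if u * p ≤ q then p else 0) = d * p := by
    intro d hd hdq
    rw [intervalIntegral.integral_congr (g := fun _ => p)]
    · simp
    · intro u hu
      rw [Set.uIcc_of_le hd] at hu
      exact if_pos ((mul_le_mul_of_nonneg_right hu.2 hp.le).trans hdq)
  rcases le_total (c * p) q with h | h
  · rw [min_eq_left h, below c hc h]
  · have hqp : q / p * p = q := div_mul_cancel₀ q hp.ne'
    have hqc : q / p ≤ c := (div_le_iff₀ hp).2 h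
    have above : ∫ u in (q / p)..c, (if u * p ≤ q then p else 0) = 0 := by
      rw [intervalIntegral.integral_congr_ae (g := fun _ => 0)]
      · simp
      · refine Filter.Eventually.of_forall fun u hu => ?_
        rw [Set.uIoc_of_le hqc] at hu
        exact if_neg (not_le.2 ((div_lt_iff₀ hp).1 hu.1))
    rw [min_eq_right h, ← intervalIntegral.integral_add_adjacent_intervals
      (antitone_threshold q hp.le).intervalIntegrable
      (antitone_threshold q hp.le).intervalIntegrable (b := q / p), above,
      below _ (by positivity) hqp.le, hqp, add_zero]

/-- Jensen's inequality for the square root on an interval. -/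
lemma integral_sqrt_le {f : ℝ → ℝ} {a b : ℝ} (hab : a < b) (hf0 : ∀ u, 0 ≤ f u)
    (hf : IntervalIntegrable f volume a b)
    (hs : IntervalIntegrable (fun u => √(f u)) volume a b) :
    ∫ u in a..b, √(f u) ≤ √((b - a) * ∫ u in a..b, f u) := by
  have hL : 0 < b - a := sub_pos.2 hab
  apply Real.le_sqrt_of_sq_le
  set I := ∫ u in a..b, √(f u) with hI
  set t := I / (b - a) with ht
  have hmono : ∫ u in a..b, (2 * t * √(f u) - t ^ 2) ≤ ∫ u in a..b, f u := by
    refine intervalIntegral.integral_mono_on hab.le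
      ((hs.const_mul _).sub intervalIntegrable_const) hf fun u _ => ?_
    nlinarith [sq_nonneg (√(f u) - t), Real.sq_sqrt (hf0 u)]
  rw [intervalIntegral.integral_sub (hs.const_mul _) intervalIntegrable_const,
    intervalIntegral.integral_const_mul, intervalIntegral.integral_const, ← hI,
    smul_eq_mul] at hmono
  have htI : t * (b - a) = I := div_mul_cancel₀ I hL.ne'
  have := mul_le_mul_of_nonneg_left hmono hL.le
  have e : (b - a) * (2 * t * I - (b - a) * t ^ 2) = I ^ 2 := by
    rw [← htI]; ring
  linarith

lemma sqrt_add_sqrt_div_two_le {x : ℝ} (h0 : 0 ≤ x) (h1 : x ≤ 1 / 2) :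
    (√(1 + 2 * x) + √(1 - 2 * x)) / 2 ≤ 1 - x ^ 2 / 2 := by
  have ha : 0 ≤ 1 + 2 * x := by linarith
  have hb : 0 ≤ 1 - 2 * x := by linarith
  have hx : x ^ 2 ≤ 1 / 4 := by nlinarith
  have hab : √(1 + 2 * x) * √(1 - 2 * x) ≤ 1 - 2 * x ^ 2 := by
    rw [← Real.sqrt_mul ha]
    apply Real.sqrt_le_iff.2
    constructor <;> nlinarith [sq_nonneg (x ^ 2)]
  refine le_of_sq_le_sq ?_ (by linarith)
  nlinarith [Real.sq_sqrt ha, Real.sq_sqrt hb, sq_nonneg (x ^ 2)]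

section EvolvingSet

variable {n : ℕ} {P : Matrix (Fin n) (Fin n) ℝ} {π : Fin n → ℝ}

lemma flowQ_nonneg (hP : ∀ x y, 0 ≤ P x y) (hπ : ∀ x, 0 ≤ π x)
    (S : Finset (Fin n)) (y : Fin n) : 0 ≤ flowQ n P π S y :=
  Finset.sum_nonneg fun x _ => mul_nonneg (hπ x) (hP x y)

lemma flowQ_add_flowQ_compl (S : Finset (Fin n)) (y : Fin n) :
    flowQ n P π S y + flowQ n P π Sᶜ y = ∑ x, π x * P x y :=
  Finset.sum_add_sum_compl S _

lemma sum_flowQ (hP : ∀ x, ∑ y, P x y = 1) (S : Finset (Fin n)) :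
    ∑ y, flowQ n P π S y = ∑ x ∈ S, π x := by
  simp only [flowQ]
  rw [Finset.sum_comm]
  simp [← Finset.mul_sum, hP]

lemma evolvedMass_eq_sum_ite (S : Finset (Fin n)) (u : ℝ) :
    evolvedMass n P π S u = ∑ y, if u * (∑ x, π x * P x y) ≤ flowQ n P π S y
      then ∑ x, π x * P x y else 0 := by
  simp [evolvedMass, Set.indicator_apply]

lemma evolvedMass_nonneg (hP : ∀ x y, 0 ≤ P x y) (hπ : ∀ x, 0 ≤ π x)
    (S : Finset (Fin n)) (u : ℝ) : 0 ≤ evolvedMass n P π S u :=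
  Finset.sum_nonneg fun y _ => Set.indicator_nonneg
    (fun y _ => Finset.sum_nonneg fun x _ => mul_nonneg (hπ x) (hP x y)) y

lemma antitone_evolvedMass (hP : ∀ x y, 0 ≤ P x y) (hπ : ∀ x, 0 ≤ π x)
    (S : Finset (Fin n)) : Antitone (evolvedMass n P π S) := by
  intro u v huv
  simp only [evolvedMass_eq_sum_ite]
  exact Finset.sum_le_sum fun y _ => antitone_threshold _
    (Finset.sum_nonneg fun x _ => mul_nonneg (hπ x) (hP x y)) huv

lemma integral_evolvedMass (hP : ∀ x y, 0 ≤ P x y) (hπ : ∀ x, 0 ≤ π x)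
    (S : Finset (Fin n)) {c : ℝ} (hc : 0 ≤ c) :
    ∫ u in (0:ℝ)..c, evolvedMass n P π S u =
      ∑ y, min (c * ∑ x, π x * P x y) (flowQ n P π S y) := by
  have hp : ∀ y, 0 ≤ ∑ x, π x * P x y := fun y =>
    Finset.sum_nonneg fun x _ => mul_nonneg (hπ x) (hP x y)
  simp only [evolvedMass_eq_sum_ite]
  rw [intervalIntegral.integral_finsetSum fun y _ =>
    (antitone_threshold _ (hp y)).intervalIntegrable]
  exact Finset.sum_congr rfl fun y _ => integral_threshold (hp y) (flowQ_nonneg hP hπ S y) hc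

lemma integral_evolvedMass_zero_one (hP : (∀ x y, 0 ≤ P x y) ∧ ∀ x, ∑ y, P x y = 1)
    (hπ : ∀ x, 0 ≤ π x) (S : Finset (Fin n)) :
    ∫ u in (0:ℝ)..1, evolvedMass n P π S u = ∑ x ∈ S, π x := by
  rw [integral_evolvedMass hP.1 hπ S zero_le_one, ← sum_flowQ hP.2 S]
  refine Finset.sum_congr rfl fun y _ => min_eq_right ?_
  have := flowQ_nonneg hP.1 hπ Sᶜ y
  have := flowQ_add_flowQ_compl (P := P) (π := π) S y
  linarith

lemma integral_evolvedMass_zero_half (hP : (∀ x y, 0 ≤ P x y) ∧ ∀ x, ∑ y, P x y = 1)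
    (hπ : ∀ x, 0 ≤ π x) (S : Finset (Fin n)) (hS : 0 < ∑ x ∈ S, π x) :
    ∫ u in (0:ℝ)..(1 / 2), evolvedMass n P π S u =
      (1 / 2 + phi n P π S) * ∑ x ∈ S, π x := by
  rw [integral_evolvedMass hP.1 hπ S (by norm_num)]
  have key : ∀ y, min (1 / 2 * ∑ x, π x * P x y) (flowQ n P π S y) =
      1 / 2 * flowQ n P π S y + 1 / 2 * min (flowQ n P π S y) (flowQ n P π Sᶜ y) := by
    intro y
    rw [← flowQ_add_flowQ_compl S y]
    rcases le_total (flowQ n P π S y) (flowQ n P π Sᶜ y) with h | h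
    · rw [min_eq_left h, min_eq_right (by linarith)]; ring
    · rw [min_eq_right h, min_eq_left (by linarith)]; ring
  simp only [key]
  rw [Finset.sum_add_distrib, ← Finset.mul_sum, ← Finset.mul_sum, sum_flowQ hP.2, phi]
  field_simp

lemma phi_nonneg (hP : ∀ x y, 0 ≤ P x y) (hπ : ∀ x, 0 ≤ π x)
    (S : Finset (Fin n)) : 0 ≤ phi n P π S :=
  mul_nonneg (one_div_nonneg.2 (mul_nonneg zero_le_two (Finset.sum_nonneg fun x _ => hπ x)))
    (Finset.sum_nonneg fun y _ => le_min (flowQ_nonneg hP hπ S y) (flowQ_nonneg hP hπ Sᶜ y))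

lemma phi_le_half (hP : ∀ x, ∑ y, P x y = 1) (S : Finset (Fin n))
    (hS : 0 < ∑ x ∈ S, π x) : phi n P π S ≤ 1 / 2 := by
  have h : ∑ y, min (flowQ n P π S y) (flowQ n P π Sᶜ y) ≤ ∑ x ∈ S, π x :=
    (Finset.sum_le_sum fun y _ => min_le_left _ _).trans_eq (sum_flowQ hP S)
  rw [phi, one_div_mul_eq_div, div_le_div_iff₀ (by positivity) two_pos]
  linarith

end EvolvingSet

/-- `1 − ψ(S) ≤ (√(1+2φ(S)) + √(1−2φ(S)))/2 ≤ 1 − φ(S)²/2`. -/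
theorem psi_phi_inequality (n : ℕ) (hn : 1 ≤ n)
    (P : Matrix (Fin n) (Fin n) ℝ)
    (hP : (∀ x y, 0 ≤ P x y) ∧ ∀ x, ∑ y, P x y = 1)
    (π : Fin n → ℝ) (hπ0 : ∀ x, 0 ≤ π x) (hπ1 : ∑ x, π x = 1)
    (S : Finset (Fin n)) (hS : 0 < ∑ x ∈ S, π x) :
    1 - psi n P π S ≤
        (Real.sqrt (1 + 2 * phi n P π S) + Real.sqrt (1 - 2 * phi n P π S)) / 2 ∧
      (Real.sqrt (1 + 2 * phi n P π S) + Real.sqrt (1 - 2 * phi n P π S)) / 2 ≤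
        1 - (phi n P π S) ^ 2 / 2 := by
  refine ⟨?_, sqrt_add_sqrt_div_two_le (phi_nonneg hP.1 hπ0 S) (phi_le_half hP.2 S hS)⟩
  set f : ℝ → ℝ := fun u => evolvedMass n P π S u / ∑ x ∈ S, π x
  have hf0 : ∀ u, 0 ≤ f u := fun u => div_nonneg (evolvedMass_nonneg hP.1 hπ0 S u) hS.le
  have hanti : Antitone f := fun u v huv =>
    div_le_div_of_nonneg_right (antitone_evolvedMass hP.1 hπ0 S huv) hS.le
  have hsqrt : Antitone fun u => √(f u) := fun u v huv => Real.sqrt_le_sqrt (hanti huv)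
  have hone : ∫ u in (0:ℝ)..1, f u = 1 := by
    rw [intervalIntegral.integral_div, integral_evolvedMass_zero_one hP hπ0, div_self hS.ne']
  have hlow : ∫ u in (0:ℝ)..(1 / 2), f u = 1 / 2 + phi n P π S := by
    rw [intervalIntegral.integral_div, integral_evolvedMass_zero_half hP hπ0 S hS,
      mul_div_cancel_right₀ _ hS.ne']
  have hhigh : ∫ u in (1 / 2 : ℝ)..1, f u = 1 / 2 - phi n P π S := by
    have := intervalIntegral.integral_add_adjacent_intervals (μ := volume)
      (hanti.intervalIntegrable (a := 0) (b := 1 / 2)) (hanti.intervalIntegrable (b := 1))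
    linarith
  have hquarter : ∀ x : ℝ, √(1 / 2 * (1 / 2 * x)) = √x / 2 := fun x => by
    rw [show (1 / 2 * (1 / 2 * x) : ℝ) = x / 2 ^ 2 by ring, Real.sqrt_div' _ (by positivity),
      Real.sqrt_sq zero_le_two]
  have jlow := integral_sqrt_le (by norm_num : (0:ℝ) < 1 / 2) hf0
    hanti.intervalIntegrable hsqrt.intervalIntegrable
  have jhigh := integral_sqrt_le (by norm_num : (1 / 2 : ℝ) < 1) hf0
    hanti.intervalIntegrable hsqrt.intervalIntegrable
  rw [hlow, show (1 / 2 - 0 : ℝ) * (1 / 2 + phi n P π S) =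
    1 / 2 * (1 / 2 * (1 + 2 * phi n P π S)) by ring, hquarter] at jlow
  rw [hhigh, show (1 - 1 / 2 : ℝ) * (1 / 2 - phi n P π S) =
    1 / 2 * (1 / 2 * (1 - 2 * phi n P π S)) by ring, hquarter] at jhigh
  rw [psi, sub_sub_cancel, ← intervalIntegral.integral_add_adjacent_intervals (μ := volume)
    (hsqrt.intervalIntegrable (a := 0) (b := 1 / 2)) (hsqrt.intervalIntegrable (b := 1))]
  linarith
end

section
/- Assume P is lazy, i.e. P(x,x) ≥ 1/2 for all x ∈ [n], and assume π(z) > 0 and π'(z) > 0 for all z ∈ [n]. Let g := min_{z∈[n]} π(z)/π'(z) and, for S ⊆ [n] with π(S) > 0, let Φ(S) := (Q(S,S^c) + Q(S^c,S))/(2π(S)), where Q(A,B) := Σ_{y∈B} Q(A,y). Then ψ(S) ≥ (1/8)·(g/(1 − g/2))²·Φ(S)². -/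
open MeasureTheory

/-- The stationary flow `Q(A,B) = ∑_{y∈B} Q(A,y)`. -/
noncomputable def flowQQ (n : ℕ) (P : Matrix (Fin n) (Fin n) ℝ) (π : Fin n → ℝ)
    (A B : Finset (Fin n)) : ℝ :=
  ∑ y ∈ B, flowQ n P π A y

/-- `Φ(S) = (Q(S,Sᶜ) + Q(Sᶜ,S)) / (2 π(S))`. -/
noncomputable def bigPhi (n : ℕ) (P : Matrix (Fin n) (Fin n) ℝ) (π : Fin n → ℝ)
    (S : Finset (Fin n)) : ℝ :=
  (flowQQ n P π S Sᶜ + flowQQ n P π Sᶜ S) / (2 * ∑ x ∈ S, π x)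

theorem integral_ite_le_const (p q b : ℝ) (hq : 0 ≤ q) (hb : 0 ≤ b) :
    ∫ u in (0:ℝ)..b, (if u ≤ q then p else 0) = p * min b q := by
  have h : (fun u : ℝ => if u ≤ q then p else 0) = (Set.Iic q).indicator (fun _ => p) := by
    ext u
    simp [Set.indicator_apply]
  rw [intervalIntegral.integral_of_le hb, h, setIntegral_indicator measurableSet_Iic,
    Set.Ioc_inter_Iic, setIntegral_const, Real.volume_real_Ioc_of_le (le_min hb hq), smul_eq_mul]
  ring

theorem antitone_ite_le_const {p : ℝ} (hp : 0 ≤ p) (q : ℝ) :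
    Antitone fun u : ℝ => if u ≤ q then p else 0 := by
  intro u v huv
  dsimp only
  split_ifs with h₁ h₂
  · exact le_rfl
  · exact absurd (huv.trans h₁) h₂
  · exact hp
  · exact le_rfl

/-- A quantitative Jensen inequality: if `X ≥ 0` has mean one on `[0, 1]` and its integrals over
the first and last segments of length `c` differ by at least `D`, then `√X` has mean at most
`1 - D² / 8`. -/
theorem sq_div_eight_le_one_sub_integral_sqrt {X : ℝ → ℝ} (hX : Antitone X) (hX0 : ∀ u, 0 ≤ X u)
    (hX1 : ∫ u in (0:ℝ)..1, X u = 1) {c D : ℝ} (hc0 : 0 ≤ c) (hc : c ≤ 1 / 2) (hD0 : 0 ≤ D)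
    (hD : D ≤ (∫ u in (0:ℝ)..c, X u) + (∫ u in (0:ℝ)..(1 - c), X u) - ∫ u in (0:ℝ)..1, X u) :
    D ^ 2 / 8 ≤ 1 - ∫ u in (0:ℝ)..1, √(X u) := by
  have hXi : ∀ a b, IntervalIntegrable X volume a b := fun a b => hX.intervalIntegrable
  have hYi : ∀ a b, IntervalIntegrable (fun u => √(X u)) volume a b := fun a b =>
    Antitone.intervalIntegrable fun u v huv => Real.sqrt_le_sqrt (hX huv)
  have hlin : ∀ r s a b : ℝ,
      IntervalIntegrable (fun u => r * (X u + 1) + s * √(X u)) volume a b := fun r s a b =>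
    (((hXi a b).add intervalIntegrable_const).const_mul r).add ((hYi a b).const_mul s)
  have hlin1 : ∀ r s : ℝ, ∫ u in (0:ℝ)..1, (r * (X u + 1) + s * √(X u))
      = r * 2 + s * ∫ u in (0:ℝ)..1, √(X u) := by
    intro r s
    rw [intervalIntegral.integral_add
      (((hXi 0 1).add intervalIntegrable_const).const_mul r) ((hYi 0 1).const_mul s),
      intervalIntegral.integral_const_mul, intervalIntegral.integral_const_mul,
      intervalIntegral.integral_add (hXi 0 1) intervalIntegrable_const, hX1]
    norm_num
  set y := ∫ u in (0:ℝ)..1, √(X u)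
  have hy1 : y ≤ 1 := by
    have h : 0 ≤ ∫ u in (0:ℝ)..1, ((1:ℝ) / 2 * (X u + 1) + (-1) * √(X u)) :=
      intervalIntegral.integral_nonneg zero_le_one fun u _ => by
        nlinarith [sq_nonneg (√(X u) - 1), Real.sq_sqrt (hX0 u)]
    rw [hlin1] at h
    linarith
  have key : ∀ ε : ℝ, 0 < ε → D ≤ (1 - y) / ε + ε * (1 + y) := by
    intro ε hε
    set G : ℝ → ℝ := fun u => (1 / (2 * ε) + ε / 2) * (X u + 1) + (ε - 1 / ε) * √(X u) with hG
    have hGi : ∀ a b, IntervalIntegrable G volume a b := fun a b => hlin _ _ a b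
    have hGeq : ∀ u, G u = (2 * ε)⁻¹ * (√(X u) - 1) ^ 2 + ε / 2 * (√(X u) + 1) ^ 2 := by
      intro u
      simp only [hG]
      nth_rewrite 1 [← Real.sq_sqrt (hX0 u)]
      field_simp
      ring
    have hGX : ∀ u, |X u - 1| ≤ G u := by
      intro u
      have hsq := Real.sq_sqrt (hX0 u)
      have h₁ : G u - (X u - 1) = (2 * ε)⁻¹ * (√(X u) - 1 - ε * (√(X u) + 1)) ^ 2 := by
        rw [hGeq]
        nth_rewrite 3 [← hsq]
        field_simp
        ring
      have h₂ : G u + (X u - 1) = (2 * ε)⁻¹ * (√(X u) - 1 + ε * (√(X u) + 1)) ^ 2 := by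
        rw [hGeq]
        nth_rewrite 3 [← hsq]
        field_simp
        ring
      have h₃ : 0 ≤ G u - (X u - 1) := by rw [h₁]; positivity
      have h₄ : 0 ≤ G u + (X u - 1) := by rw [h₂]; positivity
      exact abs_le.2 ⟨by linarith, by linarith⟩
    have hl : ∫ u in (0:ℝ)..c, (X u - 1) ≤ ∫ u in (0:ℝ)..c, G u :=
      intervalIntegral.integral_mono_on hc0 ((hXi _ _).sub intervalIntegrable_const) (hGi _ _)
        fun u _ => (le_abs_self _).trans (hGX u)
    have hm : 0 ≤ ∫ u in c..(1 - c), G u :=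
      intervalIntegral.integral_nonneg (by linarith) fun u _ => (abs_nonneg _).trans (hGX u)
    have hr : ∫ u in (1 - c)..1, (1 - X u) ≤ ∫ u in (1 - c)..1, G u :=
      intervalIntegral.integral_mono_on (by linarith)
        (intervalIntegrable_const.sub (hXi _ _)) (hGi _ _)
        fun u _ => by linarith [(neg_le_abs (X u - 1)).trans (hGX u)]
    rw [intervalIntegral.integral_sub (hXi _ _) intervalIntegrable_const] at hl
    rw [intervalIntegral.integral_sub intervalIntegrable_const (hXi _ _)] at hr
    simp only [intervalIntegral.integral_const, smul_eq_mul] at hl hr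
    have hsumX := intervalIntegral.integral_add_adjacent_intervals (hXi 0 (1 - c)) (hXi (1 - c) 1)
    have hsumG₁ := intervalIntegral.integral_add_adjacent_intervals (hGi 0 c) (hGi c (1 - c))
    have hsumG₂ := intervalIntegral.integral_add_adjacent_intervals (hGi 0 (1 - c)) (hGi (1 - c) 1)
    have hG1 : ∫ u in (0:ℝ)..1, G u = (1 - y) / ε + ε * (1 + y) := by
      rw [hG, hlin1]
      field_simp
      ring
    linarith
  have hD2 : D ≤ 2 := by
    have := key 1 one_pos
    linarith
  rcases hD0.eq_or_lt with h0 | hpos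
  · rw [← h0]
    linarith
  · have h := key (D / 4) (by positivity)
    have h' : D * (D / 4) ≤ (1 - y) + (D / 4) ^ 2 * (1 + y) := by
      calc D * (D / 4) ≤ ((1 - y) / (D / 4) + D / 4 * (1 + y)) * (D / 4) := by gcongr
        _ = _ := by field_simp
    nlinarith [mul_nonneg (sq_nonneg D) (sub_nonneg.2 hy1)]

/-- If `P` is lazy and `π, π' = πP` are strictly positive, then with
`g = min_z π(z)/π'(z)`, for every `S` with `π(S) > 0`:
`ψ(S) ≥ (1/8)·(g/(1 − g/2))²·Φ(S)²`. -/
theorem psi_ge_bigPhi_sq (n : ℕ) (hn : 1 ≤ n)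
    (P : Matrix (Fin n) (Fin n) ℝ)
    (hP : (∀ x y, 0 ≤ P x y) ∧ ∀ x, ∑ y, P x y = 1)
    (hlazy : ∀ x, (1 : ℝ) / 2 ≤ P x x)
    (π : Fin n → ℝ) (hπ0 : ∀ z, 0 < π z) (hπ1 : ∑ x, π x = 1)
    (hπ'0 : ∀ z, 0 < ∑ x, π x * P x z)
    (S : Finset (Fin n)) (hS : 0 < ∑ x ∈ S, π x) :
    (1 / 8) * ((⨅ z : Fin n, π z / ∑ x, π x * P x z) /
        (1 - (⨅ z : Fin n, π z / ∑ x, π x * P x z) / 2)) ^ 2 *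
      (bigPhi n P π S) ^ 2 ≤ psi n P π S := by
  obtain ⟨hP0, hP1⟩ := hP
  set g := ⨅ z : Fin n, π z / ∑ x, π x * P x z
  have hgle : ∀ z, g * (∑ x, π x * P x z) ≤ π z := fun z =>
    (le_div_iff₀ (hπ'0 z)).1 (ciInf_le (Set.finite_range _).bddBelow z)
  have hg0 : 0 ≤ g := Real.iInf_nonneg fun z => (div_pos (hπ0 z) (hπ'0 z)).le
  have hrow : ∀ A : Finset (Fin n), ∑ y, flowQ n P π A y = ∑ x ∈ A, π x := by
    intro A
    simp only [flowQ]
    rw [Finset.sum_comm]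
    simp [← Finset.mul_sum, hP1]
  have hg1 : g ≤ 1 := by
    have h := Finset.sum_le_sum fun z (_ : z ∈ Finset.univ) => hgle z
    have h' := hrow Finset.univ
    simp only [flowQ] at h'
    rw [← Finset.mul_sum, h', hπ1] at h
    linarith
  have hQ0 : ∀ A y, 0 ≤ flowQ n P π A y := fun A y =>
    Finset.sum_nonneg fun x _ => mul_nonneg (hπ0 x).le (hP0 x y)
  have hsplit : ∀ y, flowQ n P π S y + flowQ n P π Sᶜ y = ∑ x, π x * P x y := fun y =>
    Finset.sum_add_sum_compl S _
  have hlazyQ : ∀ A : Finset (Fin n), ∀ y ∈ A,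
      g / 2 * (∑ x, π x * P x y) ≤ flowQ n P π A y := by
    intro A y hy
    have h₁ : π y * P y y ≤ flowQ n P π A y :=
      Finset.single_le_sum (f := fun x => π x * P x y)
        (fun x _ => mul_nonneg (hπ0 x).le (hP0 x y)) hy
    nlinarith [hgle y, mul_le_mul_of_nonneg_left (hlazy y) (hπ0 y).le]
  set m := ∑ x ∈ S, π x with hm
  have hmass : ∀ u, evolvedMass n P π S u = ∑ y, if u ≤ flowQ n P π S y / ∑ x, π x * P x y
      then ∑ x, π x * P x y else 0 := by
    intro u
    simp only [evolvedMass, Set.indicator_apply, Set.mem_ofPred_eq, le_div_iff₀ (hπ'0 _)]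
  have hanti : Antitone (evolvedMass n P π S) := by
    intro u v huv
    rw [hmass, hmass]
    exact Finset.sum_le_sum fun y _ => antitone_ite_le_const (hπ'0 y).le _ huv
  have hint : ∀ b : ℝ, 0 ≤ b → ∫ u in (0:ℝ)..b, evolvedMass n P π S u / m
      = (∑ y, min (b * ∑ x, π x * P x y) (flowQ n P π S y)) / m := by
    intro b hb
    rw [intervalIntegral.integral_div]
    simp only [hmass]
    rw [intervalIntegral.integral_finsetSum fun y _ =>
      (antitone_ite_le_const (hπ'0 y).le _).intervalIntegrable]
    congr 1
    refine Finset.sum_congr rfl fun y _ => ?_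
    rw [integral_ite_le_const _ _ _ (div_nonneg (hQ0 S y) (hπ'0 y).le) hb,
      mul_min_of_nonneg _ _ (hπ'0 y).le, mul_div_cancel₀ _ (hπ'0 y).ne', mul_comm]
  have hint1 : ∫ u in (0:ℝ)..1, evolvedMass n P π S u / m = 1 := by
    rw [hint 1 zero_le_one, div_eq_one_iff_eq hS.ne', hm, ← hrow S]
    refine Finset.sum_congr rfl fun y _ => min_eq_right ?_
    linarith [hsplit y, hQ0 Sᶜ y]
  set α := g / 2 / (1 - g / 2) with hα
  have hα0 : 0 ≤ α := div_nonneg (by linarith) (by linarith)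
  have hα1 : α ≤ 1 := (div_le_one (by linarith)).2 (by linarith)
  have hαg : α * (1 - g / 2) = g / 2 := div_mul_cancel₀ _ (by linarith)
  have hflow : α * (flowQQ n P π S Sᶜ + flowQQ n P π Sᶜ S)
      ≤ ∑ y, (min (g / 2 * ∑ x, π x * P x y) (flowQ n P π S y)
        + min ((1 - g / 2) * ∑ x, π x * P x y) (flowQ n P π S y) - flowQ n P π S y) := by
    rw [← Finset.sum_compl_add_sum S, mul_add, flowQQ, flowQQ, Finset.mul_sum, Finset.mul_sum]
    refine add_le_add (Finset.sum_le_sum fun y hy => ?_) (Finset.sum_le_sum fun y hy => ?_)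
    · have h₁ := hlazyQ _ y hy
      have h₂ := hsplit y
      have h₃ : flowQ n P π S y ≤ (1 - g / 2) * ∑ x, π x * P x y := by linarith
      rw [min_eq_right h₃, add_sub_cancel_right]
      refine le_min ?_ (mul_le_of_le_one_left (hQ0 S y) hα1)
      rw [← hαg, mul_assoc]
      exact mul_le_mul_of_nonneg_left h₃ hα0
    · have h₁ := hlazyQ _ y hy
      have h₂ := hsplit y
      have h₃ : flowQ n P π Sᶜ y ≤ (1 - g / 2) * ∑ x, π x * P x y := by linarith
      have h₄ : α * flowQ n P π Sᶜ y ≤ g / 2 * ∑ x, π x * P x y := by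
        rw [← hαg, mul_assoc]
        exact mul_le_mul_of_nonneg_left h₃ hα0
      have h₅ := mul_le_of_le_one_left (hQ0 Sᶜ y) hα1
      rw [min_eq_left h₁, add_sub_assoc, ← sub_le_iff_le_add', le_sub_iff_add_le]
      exact le_min (by linarith) (by linarith)
  have hB0 : 0 ≤ flowQQ n P π S Sᶜ + flowQQ n P π Sᶜ S :=
    add_nonneg (Finset.sum_nonneg fun y _ => hQ0 _ y) (Finset.sum_nonneg fun y _ => hQ0 _ y)
  have hmain := sq_div_eight_le_one_sub_integral_sqrt
    (X := fun u => evolvedMass n P π S u / m) (c := g / 2)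
    (D := α * (flowQQ n P π S Sᶜ + flowQQ n P π Sᶜ S) / m)
    (fun u v huv => div_le_div_of_nonneg_right (hanti huv) hS.le)
    (fun u => div_nonneg (by
      rw [hmass]
      exact Finset.sum_nonneg fun y _ => by split_ifs; exacts [(hπ'0 y).le, le_rfl]) hS.le)
    hint1 (by linarith) (by linarith) (div_nonneg (mul_nonneg hα0 hB0) hS.le) (by
      rw [hint1, hint _ (by linarith), hint _ (by linarith), ← add_div,
        div_sub_one hS.ne']
      refine div_le_div_of_nonneg_right (hflow.trans_eq ?_) hS.le
      rw [Finset.sum_sub_distrib, Finset.sum_add_distrib, hrow S])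
  refine le_trans (le_of_eq ?_) hmain
  have hne : 1 - g / 2 ≠ 0 := by linarith
  rw [bigPhi, hα, ← hm]
  field_simp
end

section
/- Lower tail of the binomial degree distribution: let n ≥ 2, η > 0, p := η·log n/(n−1), and assume 0 ≤ p ≤ 1. If X is a Binomial(n−1, p) random variable, then for every c₁ with 0 < c₁ < η: P( X ≤ c₁·log n ) ≤ n^{ −η + c₁·(1 + log(η/c₁)) }. -/
open Finset

/-- Chernoff's bound for the lower tail of the binomial distribution. -/
theorem binomial_lower_tail_le_rpow_mul_exp (m : ℕ) {p r : ℝ} (hp0 : 0 ≤ p) (hp1 : p ≤ 1)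
    (hr0 : 0 < r) (hr1 : r ≤ 1) (a : ℝ) :
    ∑ k ∈ (range (m + 1)).filter (fun k : ℕ => (k : ℝ) ≤ a),
        (m.choose k : ℝ) * p ^ k * (1 - p) ^ (m - k)
      ≤ r ^ (-a) * Real.exp (-(m * p * (1 - r))) := by
  have hq : 0 ≤ 1 - p := sub_nonneg.2 hp1
  calc
    _ ≤ ∑ k ∈ (range (m + 1)).filter (fun k : ℕ => (k : ℝ) ≤ a),
        r ^ (-a) * ((r * p) ^ k * (1 - p) ^ (m - k) * (m.choose k : ℝ)) := by
      refine sum_le_sum fun k hk => ?_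
      have h1 : 1 ≤ r ^ (-a) * r ^ k := by
        rw [← Real.rpow_natCast, ← Real.rpow_add hr0]
        exact Real.one_le_rpow_of_pos_of_le_one_of_nonpos hr0 hr1
          (by linarith [(mem_filter.1 hk).2])
      calc
        _ ≤ r ^ (-a) * r ^ k * ((m.choose k : ℝ) * p ^ k * (1 - p) ^ (m - k)) :=
          le_mul_of_one_le_left (by positivity) h1
        _ = _ := by rw [mul_pow]; ring
    _ ≤ ∑ k ∈ range (m + 1),
        r ^ (-a) * ((r * p) ^ k * (1 - p) ^ (m - k) * (m.choose k : ℝ)) :=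
      sum_le_sum_of_subset_of_nonneg (filter_subset _ _) fun k _ _ => by positivity
    _ = r ^ (-a) * (r * p + (1 - p)) ^ m := by rw [← mul_sum, add_pow]
    _ ≤ r ^ (-a) * Real.exp (-(p * (1 - r))) ^ m := by
      gcongr
      linarith [Real.add_one_le_exp (-(p * (1 - r)))]
    _ = _ := by
      rw [← Real.exp_nat_mul]
      ring_nf

/-- Lower tail of the binomial degree distribution: if `X ∼ Binomial(n−1, p)` with
`p = η log n/(n−1)`, then for every `0 < c₁ < η`,
`P(X ≤ c₁ log n) ≤ n^{−η + c₁(1 + log(η/c₁))}`.  The left-hand side is written as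
the explicit binomial sum `∑_{k ≤ c₁ log n} C(n−1,k) p^k (1−p)^{n−1−k}`. -/
theorem binomial_lower_tail (n : ℕ) (hn : 2 ≤ n) (η : ℝ) (hη : 0 < η)
    (p : ℝ) (hp : p = η * Real.log n / (n - 1)) (hp0 : 0 ≤ p) (hp1 : p ≤ 1)
    (c₁ : ℝ) (hc₁ : 0 < c₁) (hc₁η : c₁ < η) :
    ∑ k ∈ (Finset.range n).filter (fun k : ℕ => (k : ℝ) ≤ c₁ * Real.log n),
        ((n - 1).choose k : ℝ) * p ^ k * (1 - p) ^ (n - 1 - k)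
      ≤ (n : ℝ) ^ (-η + c₁ * (1 + Real.log (η / c₁))) := by
  obtain ⟨m, rfl⟩ : ∃ m, n = m + 1 := ⟨n - 1, by omega⟩
  have hm : (m : ℝ) ≠ 0 := by
    exact_mod_cast (by omega : m ≠ 0)
  have hr0 : 0 < c₁ / η := div_pos hc₁ hη
  refine (binomial_lower_tail_le_rpow_mul_exp m hp0 hp1 hr0
    ((div_le_one hη).2 hc₁η.le) _).trans_eq ?_
  have hmp : m * p = η * Real.log (m + 1 : ℕ) := by
    rw [hp, Nat.cast_add_one, add_sub_cancel_right]
    field_simp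
  have hlog : Real.log (η / c₁) = -Real.log (c₁ / η) := by
    rw [← Real.log_inv, inv_div]
  rw [hmp, hlog, Real.rpow_def_of_pos hr0, Real.rpow_def_of_pos (by positivity), ← Real.exp_add]
  congr 1
  field_simp
  ring
end

section
/- Disconnection bound for supercritical Erdős–Rényi graphs: let η > 50. There exists N such that for all n ≥ N, with p := η·log n/(n−1), one has Σ_{i=1}^{⌊n/2⌋} C(n,i)·(1−p)^{i(n−i)} ≤ n^{2 − η/2}. (This sum is a union bound on the probability that the Erdős–Rényi graph G(n,p) is disconnected, counting bipartitions of the vertex set into a part of size i and its complement with no crossing edge.) -/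
open Filter in
theorem eventually_mul_log_le_sub_one {η : ℝ} (hη : 0 < η) :
    ∀ᶠ n : ℕ in atTop, η * Real.log n ≤ n - 1 := by
  have h := (Real.isLittleO_log_id_atTop.bound (show 0 < 1 / (2 * η) by positivity))
  filter_upwards [tendsto_natCast_atTop_atTop.eventually h, eventually_ge_atTop 2] with n hn h2
  have h2' : (2 : ℝ) ≤ n := by exact_mod_cast h2
  have hlog : Real.log n ≤ 1 / (2 * η) * n := by
    simpa using (le_abs_self _).trans hn
  calc η * Real.log n ≤ η * (1 / (2 * η) * n) := by gcongr
    _ = n / 2 := by field_simp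
    _ ≤ n - 1 := by linarith

theorem choose_mul_one_sub_pow_le {η : ℝ} (hη : 2 ≤ η) {n i : ℕ} (hn : 2 ≤ n)
    (hp : η * Real.log n ≤ n - 1) (hi : 1 ≤ i) (hin : i ≤ n / 2) :
    (n.choose i : ℝ) * (1 - η * Real.log n / (n - 1)) ^ (i * (n - i))
      ≤ (n : ℝ) ^ (1 - η / 2) := by
  have hn' : (2 : ℝ) ≤ n := by exact_mod_cast hn
  have hn0 : (0 : ℝ) < n := by linarith
  have hn1 : (0 : ℝ) < n - 1 := by linarith
  have hlog : 0 ≤ Real.log n := Real.log_nonneg (by linarith)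
  set p : ℝ := η * Real.log n / (n - 1) with hpdef
  have hp1 : 0 ≤ 1 - p := sub_nonneg.2 ((div_le_one hn1).2 hp)
  have hhalf : (n - 1 : ℝ) / 2 ≤ (n - i : ℕ) := by
    have : (n : ℝ) ≤ 2 * (n - i : ℕ) := by exact_mod_cast (by omega : n ≤ 2 * (n - i))
    linarith
  have hp0 : 0 ≤ p := by positivity
  have hpow : (1 - p) ^ (n - i) ≤ (n : ℝ) ^ (-(η / 2)) :=
    calc (1 - p) ^ (n - i) ≤ Real.exp (-p) ^ (n - i) := by
          gcongr
          exact Real.one_sub_le_exp_neg p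
      _ = Real.exp (-(p * (n - i : ℕ))) := by
          rw [← Real.exp_nat_mul]
          ring_nf
      _ ≤ Real.exp (-(p * ((n - 1) / 2))) := by gcongr
      _ = (n : ℝ) ^ (-(η / 2)) := by
          rw [Real.rpow_def_of_pos hn0, hpdef]
          congr 1
          field_simp
  have hchoose : (n.choose i : ℝ) ≤ (n : ℝ) ^ i := by exact_mod_cast Nat.choose_le_pow n i
  calc (n.choose i : ℝ) * (1 - p) ^ (i * (n - i))
      = n.choose i * ((1 - p) ^ (n - i)) ^ i := by rw [← pow_mul, mul_comm i]
    _ ≤ (n : ℝ) ^ i * ((n : ℝ) ^ (-(η / 2))) ^ i := by gcongr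
    _ = ((n : ℝ) ^ (1 - η / 2)) ^ i := by
        rw [← mul_pow, sub_eq_add_neg, Real.rpow_add hn0, Real.rpow_one]
    _ ≤ (n : ℝ) ^ (1 - η / 2) :=
        pow_le_of_le_one (by positivity)
          (Real.rpow_le_one_of_one_le_of_nonpos (by linarith) (by linarith)) (by omega)

/-- Disconnection bound for supercritical Erdős–Rényi graphs: for `η > 50` there is
`N` such that for all `n ≥ N`, with `p = η log n/(n−1)`,
`∑_{i=1}^{⌊n/2⌋} C(n,i) (1−p)^{i(n−i)} ≤ n^{2 − η/2}`. -/
theorem er_disconnection_bound (η : ℝ) (hη : 50 < η) :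
    ∃ N : ℕ, ∀ n : ℕ, N ≤ n →
      ∑ i ∈ Finset.Icc 1 (n / 2),
          (n.choose i : ℝ) * (1 - η * Real.log n / (n - 1)) ^ (i * (n - i))
        ≤ (n : ℝ) ^ ((2 : ℝ) - η / 2) := by
  obtain ⟨N, hN⟩ := Filter.eventually_atTop.1
    ((eventually_mul_log_le_sub_one (by linarith : 0 < η)).and (Filter.eventually_ge_atTop 2))
  refine ⟨N, fun n hn => ?_⟩
  obtain ⟨hp, h2⟩ := hN n hn
  have hn0 : (0 : ℝ) < n := by exact_mod_cast (by omega : 0 < n)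
  calc _ ≤ ∑ _i ∈ Finset.Icc 1 (n / 2), (n : ℝ) ^ (1 - η / 2) := by
        refine Finset.sum_le_sum fun i hi => ?_
        obtain ⟨hi1, hi2⟩ := Finset.mem_Icc.1 hi
        exact choose_mul_one_sub_pow_le (by linarith) h2 hp hi1 hi2
    _ = (n / 2 : ℕ) * (n : ℝ) ^ (1 - η / 2) := by simp
    _ ≤ n * (n : ℝ) ^ (1 - η / 2) := by
        gcongr
        exact Nat.div_le_self n 2
    _ = (n : ℝ) ^ ((2 : ℝ) - η / 2) := by
        rw [← Real.rpow_one_add' hn0.le (by linarith)]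
        ring_nf
end
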